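/- arXiv:2108.12774 — 7 statements merged into one kernel-verified Lean document; each statement's English description precedes it below -/
import Mathlib

section
/- For every n ∈ ℕ, every NFA over a one-symbol alphabet {a} with a finite state type whose accepted language is exactly the singleton language {a^(2^n)} (the language containing only the word consisting of 2^n copies of a) has at least 2^n states. -/
/-- An NFA whose language is a single word `x` has more than `x.length` states: the states along
an accepting run of `x` are distinct, since a repetition could be cut out to give a shorter
accepted word. -/
theorem NFA.length_lt_card_of_accepts_eq_singleton {α σ : Type*} [Fintype σ] (M : NFA α σ)
    {x : List α} (hM : M.accepts = {x}) : x.length < Fintype.card σ := by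
  have mem_iff (y : List α) : y ∈ M.accepts ↔ y = x := by rw [hM]; exact Iff.rfl
  have hrun (k : Fin (x.length + 1)) :
      ∃ q ∈ M.eval (x.take k), x.drop k ∈ M.acceptsFrom {q} := by
    have hx : x.take k ++ x.drop k ∈ M.accepts := by simp [mem_iff]
    rw [NFA.accepts_eq_acceptsFrom_start, NFA.append_mem_acceptsFrom] at hx
    obtain ⟨t, ht, h⟩ := hx
    obtain ⟨q, hq, h⟩ := NFA.mem_evalFrom_iff_exists.1 h
    exact ⟨q, hq, t, ht, h⟩
  choose q hq hacc using hrun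
  have hle (i j : Fin (x.length + 1)) (h : q i = q j) : j ≤ i := by
    have hmem : x.take i ++ x.drop j ∈ M.accepts := by
      rw [NFA.accepts_eq_acceptsFrom_start, NFA.append_mem_acceptsFrom]
      obtain ⟨t, ht, hj⟩ := hacc j
      exact ⟨t, ht, NFA.mem_evalFrom_iff_exists.2 ⟨q j, h ▸ hq i, hj⟩⟩
    have hlen := congrArg List.length ((mem_iff _).1 hmem)
    simp only [List.length_append, List.length_take, List.length_drop] at hlen
    omega
  have hinj : Function.Injective q := fun i j h => le_antisymm (hle j i h.symm) (hle i j h)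
  simpa [Nat.succ_le_iff] using Fintype.card_le_of_injective q hinj

/-- Every NFA over the one-symbol alphabet `Unit` with a finite state type whose
language is exactly the singleton `{a^(2^n)}` has at least `2^n` states. -/
theorem nfa_singleton_two_pow_states (n : ℕ) (Q : Type) [Fintype Q] (M : NFA Unit Q)
    (hM : M.accepts = {List.replicate (2 ^ n) ()}) :
    2 ^ n ≤ Fintype.card Q := by
  simpa using (M.length_lt_card_of_accepts_eq_singleton hM).le
end

section
/- Let Q be a finite set of states, V a finite alphabet, T ⊆ Q^6, f : Q → Language(V), and wt_n = F^n(f). Then there exists n ∈ ℕ such that for all m ≥ n and all q ∈ Q, wt_m(q) ≡_K wt_n(q); moreover, for this n, the pointwise union W(q) = ⋃_{i ∈ ℕ} wt_i(q) satisfies W(q) ≡_K wt_n(q) for all q ∈ Q. -/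
/-- The operator `F` associated to a set `T` of transitions (a head state and five
successor states) and acting on exit-weight functions `g : Q → Language V`. -/
def Fop {Q V : Type} (T : Set (Q × Q × Q × Q × Q × Q)) (g : Q → Language V) :
    Q → Language V := fun q =>
  g q ⊔ ⨆ t ∈ T, ⨆ (_ : t.1 = q),
    g t.2.1 * g t.2.2.1 * g t.2.2.2.1 * g t.2.2.2.2.1 * g t.2.2.2.2.2

/-- The set of letter-sets of the words of a language. -/
def letterSets {V : Type} [DecidableEq V] (L : Language V) : Set (Finset V) :=
  (fun w : List V => w.toFinset) '' L

/-- Two languages are K-equivalent iff they have the same letter-sets. -/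
def KEquiv {V : Type} [DecidableEq V] (L L' : Language V) : Prop :=
  letterSets L = letterSets L'

theorem letterSets_mono {V : Type} [DecidableEq V] : Monotone (letterSets (V := V)) :=
  fun _ _ h => Set.image_mono h

theorem letterSets_iSup {V ι : Type} [DecidableEq V] (L : ι → Language V) :
    letterSets (⨆ i, L i) = ⋃ i, letterSets (L i) :=
  Set.image_iUnion

theorem le_Fop {Q V : Type} (T : Set (Q × Q × Q × Q × Q × Q)) (g : Q → Language V) :
    g ≤ Fop T g :=
  fun _ => le_sup_left

theorem monotone_iterate_Fop {Q V : Type} (T : Set (Q × Q × Q × Q × Q × Q))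
    (f : Q → Language V) : Monotone fun n => (Fop T)^[n] f :=
  monotone_nat_of_le_succ fun n => by
    rw [Function.iterate_succ_apply']
    exact le_Fop T _

/-- For finite `Q` and finite alphabet `V`, the iteration `wt_n = F^n(f)` stabilises
up to K-equivalence: there is an `n` such that `wt_m(q) ≡_K wt_n(q)` for all `m ≥ n`
and all `q`; moreover the pointwise union `W(q) = ⋃_i wt_i(q)` is K-equivalent to
`wt_n(q)` for all `q`. -/
theorem wt_stabilises {Q V : Type} [Finite Q] [Finite V] [DecidableEq V]
    (T : Set (Q × Q × Q × Q × Q × Q)) (f : Q → Language V) :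
    ∃ n : ℕ,
      (∀ m : ℕ, n ≤ m → ∀ q : Q, KEquiv ((Fop T)^[m] f q) ((Fop T)^[n] f q)) ∧
      (∀ q : Q, KEquiv (⨆ i, (Fop T)^[i] f q) ((Fop T)^[n] f q)) := by
  obtain ⟨n, hn⟩ := WellFoundedGT.monotone_chain_condition
    (⟨fun n q => letterSets ((Fop T)^[n] f q),
      fun _ _ h q => letterSets_mono (monotone_iterate_Fop T f h q)⟩ :
      ℕ →o (Q → Set (Finset V)))
  have stable : ∀ m, n ≤ m → ∀ q,
      letterSets ((Fop T)^[m] f q) = letterSets ((Fop T)^[n] f q) :=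
    fun m hm q => (congrFun (hn m hm) q).symm
  refine ⟨n, stable, fun q => ?_⟩
  rw [KEquiv, letterSets_iSup]
  refine (Set.iUnion_subset fun i => ?_).antisymm
    (Set.subset_iUnion (fun i => letterSets ((Fop T)^[i] f q)) n)
  rw [← stable (max i n) (le_max_right i n) q]
  exact letterSets_mono (monotone_iterate_Fop T f (le_max_left i n) q)
end

section
/- Let Q be a finite set of states, V a finite alphabet, T ⊆ Q^6, f : Q → Language(V), and wt_n = F^n(f). Let N := |Q| · (|V| + 1). Then for all m ≥ N and all q ∈ Q, wt_m(q) ≡_K wt_N(q); that is, the iteration stabilises up to K-equivalence after at most |Q|·(|V|+1) steps, a number polynomial in |Q| and |V|. -/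
/-- Letter-sets turn concatenation of languages into pairwise union. -/
theorem mem_letterSets_mul {V : Type} [DecidableEq V] {L M : Language V} {S : Finset V} :
    S ∈ letterSets (L * M) ↔ ∃ A ∈ letterSets L, ∃ B ∈ letterSets M, A ∪ B = S := by
  constructor
  · rintro ⟨w, hw, rfl⟩
    obtain ⟨u, hu, v, hv, rfl⟩ := Language.mem_mul.1 hw
    exact ⟨_, ⟨u, hu, rfl⟩, _, ⟨v, hv, rfl⟩, List.toFinset_append.symm⟩
  · rintro ⟨_, ⟨u, hu, rfl⟩, _, ⟨v, hv, rfl⟩, rfl⟩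
    exact ⟨u ++ v, Language.mem_mul.2 ⟨u, hu, v, hv, rfl⟩, List.toFinset_append⟩

theorem mem_letterSets_Fop {Q V : Type} [DecidableEq V] {T : Set (Q × Q × Q × Q × Q × Q)}
    {g : Q → Language V} {q : Q} {S : Finset V} :
    S ∈ letterSets (Fop T g q) ↔ S ∈ letterSets (g q) ∨ ∃ t ∈ T, t.1 = q ∧
      S ∈ letterSets (g t.2.1 * g t.2.2.1 * g t.2.2.2.1 * g t.2.2.2.2.1 * g t.2.2.2.2.2) := by
  have mem_Fop (w : List V) : w ∈ Fop T g q ↔ w ∈ g q ∨ ∃ t ∈ T, t.1 = q ∧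
      w ∈ g t.2.1 * g t.2.2.1 * g t.2.2.2.1 * g t.2.2.2.2.1 * g t.2.2.2.2.2 := by
    change w ∈ g q + _ ↔ _
    rw [Language.mem_add]
    simp only [Language.mem_iSup, exists_prop]
  constructor
  · rintro ⟨w, hw, rfl⟩
    rcases (mem_Fop w).1 hw with h | ⟨t, ht, hq, h⟩
    · exact Or.inl ⟨w, h, rfl⟩
    · exact Or.inr ⟨t, ht, hq, w, h, rfl⟩
  · rintro (⟨w, h, rfl⟩ | ⟨t, ht, hq, w, h, rfl⟩)
    · exact ⟨w, (mem_Fop w).2 (Or.inl h), rfl⟩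
    · exact ⟨w, (mem_Fop w).2 (Or.inr ⟨t, ht, hq, h⟩), rfl⟩

/-- Whether `S` is a letter-set of `L * M` only depends on the letter-sets of `L` and `M` that
are contained in `S`. -/
theorem mem_letterSets_mul_of_forall_subset {V : Type} [DecidableEq V] {L M L' M' : Language V}
    {S : Finset V} (hL : ∀ A ⊆ S, A ∈ letterSets L → A ∈ letterSets L')
    (hM : ∀ A ⊆ S, A ∈ letterSets M → A ∈ letterSets M') :
    ∀ A ⊆ S, A ∈ letterSets (L * M) → A ∈ letterSets (L' * M') := by
  intro C hC h
  obtain ⟨A, hA, B, hB, rfl⟩ := mem_letterSets_mul.1 h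
  exact mem_letterSets_mul.2 ⟨A, hL A (Finset.union_subset_left hC) hA,
    B, hM B (Finset.union_subset_right hC) hB, rfl⟩

theorem mem_letterSets_Fop_of_forall_subset {Q V : Type} [DecidableEq V]
    {T : Set (Q × Q × Q × Q × Q × Q)} {g g' : Q → Language V} {S : Finset V}
    (h : ∀ q, ∀ A ⊆ S, A ∈ letterSets (g q) → A ∈ letterSets (g' q)) {q : Q}
    (hS : S ∈ letterSets (Fop T g q)) : S ∈ letterSets (Fop T g' q) := by
  rw [mem_letterSets_Fop] at hS ⊢
  refine hS.imp (h q S subset_rfl) ?_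
  rintro ⟨t, ht, hq, hw⟩
  exact ⟨t, ht, hq, mem_letterSets_mul_of_forall_subset (mem_letterSets_mul_of_forall_subset
    (mem_letterSets_mul_of_forall_subset (mem_letterSets_mul_of_forall_subset
    (h _) (h _)) (h _)) (h _)) (h _) S subset_rfl hw⟩

theorem monotone_letterSets_iterate_Fop {Q V : Type} [DecidableEq V]
    (T : Set (Q × Q × Q × Q × Q × Q)) (f : Q → Language V) (q : Q) :
    Monotone fun n => letterSets ((Fop T)^[n] f q) := by
  refine monotone_nat_of_le_succ fun n S hS => ?_
  rw [Function.iterate_succ_apply', mem_letterSets_Fop]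
  exact Or.inl hS

/-- A letter-set `S` that ever occurs at a state already occurs there after `|Q|·(|S|+1)` steps:
once all proper subsets of `S` have stabilised, the set of states admitting `S` stops growing
as soon as it fails to grow once. -/
theorem mem_letterSets_iterate_Fop_card {Q V : Type} [Fintype Q] [DecidableEq V]
    (T : Set (Q × Q × Q × Q × Q × Q)) (f : Q → Language V) (S : Finset V) :
    ∀ (m : ℕ) (q : Q), S ∈ letterSets ((Fop T)^[m] f q) →
      S ∈ letterSets ((Fop T)^[Fintype.card Q * (S.card + 1)] f q) := by
  induction S using Finset.strongInduction with
  | H S ih =>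
    set k := Fintype.card Q * S.card
    let A : ℕ → Set Q := fun n => {q | S ∈ letterSets ((Fop T)^[k + n] f q)}
    have hA : Monotone A := fun a b hab q h =>
      monotone_letterSets_iterate_Fop T f q (Nat.add_le_add_left hab k) h
    have stable (n : ℕ) (hn : A n = A (n + 1)) : A (n + 1) = A (n + 2) := by
      refine (hA (Nat.le_succ _)).antisymm fun q h => ?_
      change S ∈ letterSets ((Fop T)^[k + n + 1 + 1] f q) at h
      change S ∈ letterSets ((Fop T)^[k + n + 1] f q)
      rw [Function.iterate_succ_apply'] at h ⊢
      refine mem_letterSets_Fop_of_forall_subset (fun p B hB hp => ?_) h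
      rcases hB.eq_or_ssubset with rfl | hB
      · exact hn.ge hp
      · refine monotone_letterSets_iterate_Fop T f p ?_ (ih B hB _ p hp)
        exact (Nat.mul_le_mul_left _ (Finset.card_lt_card hB)).trans (Nat.le_add_right _ _)
    have card_stable {n : ℕ} (hn : Fintype.card Q ≤ n) :
        (A n).ncard = (A (Fintype.card Q)).ncard := by
      refine Nat.stabilises_of_monotone (f := fun n => (A n).ncard)
        (fun a b hab => Set.ncard_le_ncard (hA hab)) (fun n => ?_) (fun n hn => ?_) hn
      · exact (Set.ncard_le_card _).trans_eq Nat.card_eq_fintype_card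
      · exact congrArg Set.ncard
          (stable n (Set.eq_of_subset_of_ncard_le (hA (Nat.le_succ n)) hn.ge))
    intro m q hm
    have hq : q ∈ A (Fintype.card Q + m) :=
      monotone_letterSets_iterate_Fop T f q (by omega : m ≤ k + (Fintype.card Q + m)) hm
    rw [← Set.eq_of_subset_of_ncard_le (hA (Nat.le_add_right _ m))
      (card_stable (Nat.le_add_right _ m)).le] at hq
    exact hq

/-- The iteration `wt_n = F^n(f)` stabilises up to K-equivalence after at most
`N = |Q|·(|V|+1)` steps, a number polynomial in `|Q|` and `|V|`. -/
theorem wt_stabilises_poly {Q V : Type} [Fintype Q] [Fintype V] [DecidableEq V]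
    (T : Set (Q × Q × Q × Q × Q × Q)) (f : Q → Language V) :
    ∀ m : ℕ, Fintype.card Q * (Fintype.card V + 1) ≤ m → ∀ q : Q,
      KEquiv ((Fop T)^[m] f q) ((Fop T)^[Fintype.card Q * (Fintype.card V + 1)] f q) := by
  intro m hm q
  refine Set.Subset.antisymm (fun S hS => ?_) (monotone_letterSets_iterate_Fop T f q hm)
  exact monotone_letterSets_iterate_Fop T f q
    (Nat.mul_le_mul_left _ (Nat.add_le_add_right (Finset.card_le_univ S) 1))
    (mem_letterSets_iterate_Fop_card T f S m q hS)
end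

section
/- Let σ = σ1⋯σk be a duplicate-free word with k ≥ 1 over an alphabet Σ. A word w over Σ belongs to L(σ) = {σ1}⁺·{σ2}·({σ1} ∪ {σ2})*·{σ3}·({σ1} ∪ {σ2} ∪ {σ3})*· ⋯ ·{σk}·({σ1} ∪ ⋯ ∪ {σk})* if and only if firstOcc(w) = σ, i.e., the distinct symbols of w, listed in order of their first occurrence, are exactly σ1, …, σk in that order. -/
open Computability
/-- `firstOcc w` is the duplicate-free word listing the distinct symbols of `w`
in the order of their first occurrence in `w`. -/
def firstOcc {α : Type} [DecidableEq α] (w : List α) : List α :=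
  w.reverse.dedup.reverse

/-- The star `(⋃_{s ∈ seen} {s})*` of the union of the singleton languages of
the symbols in the list `seen`. -/
def seenStar {α : Type} [DecidableEq α] (seen : List α) : Language α :=
  (⨆ s ∈ seen, ({[s]} : Language α))∗

/-- `LsigAux seen σ` is `{σ1}·(seen∪{σ1})*·{σ2}·(seen∪{σ1,σ2})*·…`, accumulating
seen symbols. -/
def LsigAux {α : Type} [DecidableEq α] : List α → List α → Language α
  | _, [] => 1
  | seen, s :: rest => {[s]} * seenStar (s :: seen) * LsigAux (s :: seen) rest

/-- For a duplicate-free word `σ = σ1⋯σk`, `Lsig σ` is the language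
`{σ1}⁺·{σ2}·({σ1}∪{σ2})*·{σ3}·({σ1}∪{σ2}∪{σ3})*·⋯·{σk}·({σ1}∪⋯∪{σk})*`. -/
def Lsig {α : Type} [DecidableEq α] (σ : List α) : Language α :=
  LsigAux [] σ

theorem List.dedup_concat_eq_filter {α : Type*} [DecidableEq α] (l : List α) (a : α) :
    (l ++ [a]).dedup = l.dedup.filter (· ≠ a) ++ [a] := by
  induction l with
  | nil => simp
  | cons b l ih =>
    rw [List.cons_append]
    by_cases hb : b ∈ l
    · rw [List.dedup_cons_of_mem (by simp [hb]), List.dedup_cons_of_mem hb, ih]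
    · by_cases hba : b = a
      · subst hba
        rw [List.dedup_cons_of_mem (by simp), List.dedup_cons_of_notMem hb, ih]
        simp
      · rw [List.dedup_cons_of_notMem (by simp [hb, hba]), List.dedup_cons_of_notMem hb, ih]
        simp [hba]

theorem firstOcc_cons {α : Type} [DecidableEq α] (a : α) (w : List α) :
    firstOcc (a :: w) = a :: (firstOcc w).filter (· ≠ a) := by
  simp [firstOcc, List.dedup_concat_eq_filter, List.filter_reverse]

theorem mem_firstOcc {α : Type} [DecidableEq α] {a : α} {w : List α} :
    a ∈ firstOcc w ↔ a ∈ w := by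
  simp [firstOcc]

theorem mem_seenStar {α : Type} [DecidableEq α] {seen w : List α} :
    w ∈ seenStar seen ↔ ∀ a ∈ w, a ∈ seen := by
  have hmem (y : List α) :
      y ∈ (⨆ s ∈ seen, ({[s]} : Language α)) ↔ ∃ s ∈ seen, y = [s] := by
    change y ∈ (⨆ s ∈ seen, ({[s]} : Set (List α))) ↔ _
    simp [Set.mem_iUnion]
  rw [seenStar, Language.mem_kstar]
  constructor
  · rintro ⟨L, rfl, hL⟩ a ha
    obtain ⟨y, hy, hay⟩ := List.mem_flatten.1 ha
    obtain ⟨s, hs, rfl⟩ := (hmem y).1 (hL y hy)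
    rwa [List.mem_singleton.1 hay]
  · intro h
    refine ⟨w.map fun a => [a], (List.flatMap_singleton' w).symm, fun y hy => ?_⟩
    obtain ⟨a, ha, rfl⟩ := List.mem_map.1 hy
    exact (hmem _).2 ⟨a, h a ha, rfl⟩

/-- The unseen symbols of `w` start with `s` exactly when `w` splits at the first occurrence
of `s` into a prefix of seen symbols and a remainder. -/
theorem filter_firstOcc_eq_cons_iff {α : Type} [DecidableEq α] {seen rest w : List α} {s : α}
    (hs : s ∉ seen) :
    (firstOcc w).filter (· ∉ seen) = s :: rest ↔
      ∃ u v, (∀ a ∈ u, a ∈ seen) ∧ (firstOcc v).filter (· ∉ s :: seen) = rest ∧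
        u ++ s :: v = w := by
  induction w with
  | nil => simp [firstOcc]
  | cons b w ih =>
    rw [firstOcc_cons]
    by_cases hb : b ∈ seen
    · have hfilter : (b :: (firstOcc w).filter (· ≠ b)).filter (· ∉ seen) =
          (firstOcc w).filter (· ∉ seen) := by
        rw [List.filter_cons_of_neg (by simpa using hb), List.filter_filter]
        refine List.filter_congr fun x _ => ?_
        grind
      rw [hfilter, ih]
      constructor
      · rintro ⟨u, v, hu, hv, rfl⟩
        exact ⟨b :: u, v, by simpa [hb] using hu, hv, rfl⟩
      · rintro ⟨u, v, hu, hv, h⟩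
        cases u with
        | nil => grind
        | cons c u => exact ⟨u, v, by grind, hv, by grind⟩
    · have hfilter : (b :: (firstOcc w).filter (· ≠ b)).filter (· ∉ seen) =
          b :: (firstOcc w).filter (· ∉ b :: seen) := by
        rw [List.filter_cons_of_pos (by simpa using hb), List.filter_filter]
        congr 1
        refine List.filter_congr fun x _ => ?_
        grind
      rw [hfilter, List.cons.injEq]
      constructor
      · rintro ⟨rfl, h⟩
        exact ⟨[], w, by simp, h, rfl⟩
      · rintro ⟨u, v, hu, hv, h⟩
        cases u with
        | nil =>
          obtain ⟨rfl, rfl⟩ := List.cons.inj h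
          exact ⟨rfl, hv⟩
        | cons c u => grind

theorem mem_seenStar_mul_LsigAux_iff {α : Type} [DecidableEq α] {σ : List α} (hnd : σ.Nodup)
    {seen : List α} (hdisj : ∀ a ∈ σ, a ∉ seen) (w : List α) :
    w ∈ seenStar seen * LsigAux seen σ ↔ (firstOcc w).filter (· ∉ seen) = σ := by
  induction σ generalizing seen w with
  | nil =>
    rw [LsigAux, mul_one, mem_seenStar]
    simp [List.filter_eq_nil_iff, mem_firstOcc]
  | cons s rest ih =>
    rw [List.nodup_cons] at hnd
    have ih' := ih hnd.2 (seen := s :: seen) (by grind)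
    rw [filter_firstOcc_eq_cons_iff (hdisj s (by simp)), LsigAux, mul_assoc {[s]},
      Language.mem_mul]
    constructor
    · rintro ⟨u, hu, x, hx, rfl⟩
      obtain ⟨y, hy, v, hv, rfl⟩ := Language.mem_mul.1 hx
      obtain rfl : y = [s] := hy
      exact ⟨u, v, mem_seenStar.1 hu, (ih' v).1 hv, rfl⟩
    · rintro ⟨u, v, hu, hv, rfl⟩
      exact ⟨u, mem_seenStar.2 hu, s :: v,
        Language.mem_mul.2 ⟨[s], rfl, v, (ih' v).2 hv, rfl⟩, rfl⟩

/-- For a nonempty duplicate-free word `σ`, a word `w` belongs to `Lsig σ` iff the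
distinct symbols of `w`, listed in order of first occurrence, are exactly `σ`. -/
theorem mem_Lsig_iff {α : Type} [DecidableEq α] (σ : List α) (hnd : σ.Nodup)
    (hne : σ ≠ []) (w : List α) :
    w ∈ Lsig σ ↔ firstOcc w = σ := by
  have hone : seenStar ([] : List α) = 1 := by
    ext x
    simp [mem_seenStar, List.eq_nil_iff_forall_not_mem]
  simpa [Lsig, hone] using mem_seenStar_mul_LsigAux_iff hnd (seen := []) (by simp) w
end

section
/- Let σ = σ1⋯σk be a duplicate-free word with k ≥ 1 over an alphabet Σ. Then there exists an NFA over Σ with state type Fin (k+1) (i.e., with exactly k+1 states) whose accepted language is L(σ). -/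
open Computability

/-- The empty word lies in `seenStar seen * LsigAux seen rest` exactly when no symbol remains. -/
theorem nil_mem_seenStar_mul_LsigAux {α : Type} [DecidableEq α] (seen rest : List α) :
    [] ∈ seenStar seen * LsigAux seen rest ↔ rest = [] := by
  cases rest with
  | nil => simp [LsigAux, seenStar, Language.nil_mem_kstar]
  | cons s rest =>
    have h : ([] : List α) ∉ ({[s]} : Language α) := fun h => List.cons_ne_nil s [] h.symm
    simp [LsigAux, Language.mem_mul, h]

/-- A nonempty word of `seenStar seen * LsigAux seen rest` starts either with a symbol already
seen or with the next symbol of `rest`. -/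
theorem cons_mem_seenStar_mul_LsigAux {α : Type} [DecidableEq α] (seen rest : List α)
    (a : α) (w : List α) :
    a :: w ∈ seenStar seen * LsigAux seen rest ↔
      (a ∈ seen ∧ w ∈ seenStar seen * LsigAux seen rest) ∨
        ∃ rest', rest = a :: rest' ∧
          w ∈ seenStar (a :: seen) * LsigAux (a :: seen) rest' := by
  have letter (l : Language α) (s : α) : a :: w ∈ ({[s]} : Language α) * l ↔ a = s ∧ w ∈ l := by
    simp only [Language.mem_mul]
    constructor
    · rintro ⟨x, rfl, y, hy, h⟩
      simp only [List.cons_append, List.nil_append, List.cons.injEq] at h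
      obtain ⟨rfl, rfl⟩ := h
      exact ⟨rfl, hy⟩
    · rintro ⟨rfl, h⟩
      exact ⟨[a], rfl, w, h, rfl⟩
  have head : a :: w ∈ LsigAux seen rest ↔ ∃ rest', rest = a :: rest' ∧
      w ∈ seenStar (a :: seen) * LsigAux (a :: seen) rest' := by
    cases rest with
    | nil => simp [LsigAux, Language.mem_one]
    | cons s rest =>
      rw [LsigAux, mul_assoc, letter]
      grind
  have unfold_star : seenStar seen * LsigAux seen rest = LsigAux seen rest +
      (⨆ s ∈ seen, ({[s]} : Language α)) * (seenStar seen * LsigAux seen rest) := by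
    conv_lhs =>
      rw [seenStar, ← Language.one_add_self_mul_kstar_eq_kstar, add_mul, one_mul, mul_assoc]
    rfl
  rw [unfold_star, Language.mem_add, head, ← unfold_star]
  simp only [Language.iSup_mul, Language.mem_iSup, letter]
  grind

/-- The automaton whose state `i` records that the first `i` symbols of `σ` have been seen: it
loops on these symbols and moves to the state `i + 1` on the next symbol of `σ`. -/
def prefixNFA {α : Type} (σ : List α) : NFA α (Fin (σ.length + 1)) where
  step i a := {j | (j = i ∧ a ∈ σ.take i) ∨ (j.val = i.val + 1 ∧ σ[i.val]? = some a)}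
  start := {0}
  accept := {Fin.last σ.length}

theorem mem_acceptsFrom_prefixNFA {α : Type} [DecidableEq α] (σ : List α) (w : List α)
    (i : Fin (σ.length + 1)) :
    w ∈ (prefixNFA σ).acceptsFrom {i} ↔
      w ∈ seenStar (σ.take i).reverse * LsigAux (σ.take i).reverse (σ.drop i) := by
  induction w generalizing i with
  | nil =>
    rw [nil_mem_seenStar_mul_LsigAux]
    have last_iff : i = Fin.last σ.length ↔ σ.length ≤ i := by
      rw [Fin.ext_iff, Fin.val_last]
      omega
    simp [prefixNFA, last_iff]
  | cons a w ih =>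
    rw [cons_mem_seenStar_mul_LsigAux, NFA.cons_mem_acceptsFrom, NFA.stepSet_singleton]
    have split (S : Set (Fin (σ.length + 1))) : w ∈ (prefixNFA σ).acceptsFrom S ↔
        ∃ j ∈ S, w ∈ (prefixNFA σ).acceptsFrom {j} := by
      simp only [NFA.mem_acceptsFrom, NFA.mem_evalFrom_iff_exists (S := S)]
      grind
    have reverse_take (hi : i.val < σ.length) :
        (σ.take (i + 1)).reverse = σ[i.val] :: (σ.take i).reverse := by
      rw [← List.take_concat_get' σ i hi, List.reverse_append, List.reverse_singleton,
        List.singleton_append]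
    rw [split]
    simp only [ih]
    constructor
    · rintro ⟨j, ⟨rfl, h⟩ | ⟨hj, h⟩, hw⟩
      · exact Or.inl ⟨by simpa using h, hw⟩
      · obtain ⟨hi, rfl⟩ := List.getElem?_eq_some_iff.mp h
        refine Or.inr ⟨σ.drop (i + 1), List.drop_eq_getElem_cons hi, ?_⟩
        rwa [hj, reverse_take hi] at hw
    · rintro (⟨h, hw⟩ | ⟨rest, h, hw⟩)
      · exact ⟨i, Or.inl ⟨rfl, by simpa using h⟩, hw⟩
      · have hi : i.val < σ.length := by
          by_contra hi
          simp [List.drop_eq_nil_of_le (not_lt.mp hi)] at h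
        rw [List.drop_eq_getElem_cons hi, List.cons.injEq] at h
        obtain ⟨rfl, rfl⟩ := h
        refine ⟨⟨i + 1, by omega⟩, Or.inr ⟨rfl, List.getElem?_eq_getElem hi⟩, ?_⟩
        rwa [reverse_take hi]

/-- For a duplicate-free word `σ` of length `k ≥ 1`, there is an NFA with exactly
`k + 1` states accepting `Lsig σ`. -/
theorem Lsig_isAccepted_by_small_nfa {α : Type} [DecidableEq α] (σ : List α)
    (hnd : σ.Nodup) (hne : σ ≠ []) :
    ∃ M : NFA α (Fin (σ.length + 1)), M.accepts = Lsig σ := by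
  refine ⟨prefixNFA σ, ?_⟩
  ext w
  have seenStar_nil : seenStar ([] : List α) = 1 := by
    simp [seenStar, show (⊥ : Language α) = 0 from rfl]
  have h := mem_acceptsFrom_prefixNFA σ w 0
  rw [Fin.val_zero, List.take_zero, List.drop_zero, List.reverse_nil, seenStar_nil, one_mul] at h
  exact h
end

section
/- Let Σ = {u, v} be a two-symbol alphabet, let Q = {aa, ab, ba, bb} be a four-element state set, and define f : Q → Language(Σ) by f(aa) = f(bb) = {ε}, f(ab) = {u}, f(ba) = {v}. Define the operator G on functions g : Q → Language(Σ) by G(g)(xz) = g(xz) ∪ ⋃_{y ∈ {a,b}} g(xy)·g(yz) (where xy denotes the state corresponding to the pair (x,y)). Then the least function g with f ≤ g pointwise and g(xy)·g(yz) ⊆ g(xz) for all x, y, z ∈ {a,b} — equivalently, the pointwise union ⋃_{n ∈ ℕ} G^n(f) — satisfies g(ab) = ({u}·{v})*·{u}, i.e., g(ab) = { (uv)^n u | n ∈ ℕ }. -/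
open Computability

/-- Exit weights for the TBox `{(A ⊑ B, u), (B ⊑ A, v)}`: states are pairs over
`{a, b}` (encoded as `Fin 2`, with `A = 0`, `B = 1`), the symbol `u` is `0 : Fin 2`
and `v` is `1 : Fin 2`; `f(aa) = f(bb) = {ε}`, `f(ab) = {u}`, `f(ba) = {v}`. -/
def exitF : Fin 2 × Fin 2 → Language (Fin 2) := fun p =>
  if p.1 = p.2 then 1 else if p.1 = 0 then {[0]} else {[1]}

/-- The transitivity operator
`G(g)(xz) = g(xz) ∪ ⋃_{y} g(xy)·g(yz)`. -/
def Gop (g : Fin 2 × Fin 2 → Language (Fin 2)) : Fin 2 × Fin 2 → Language (Fin 2) :=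
  fun p => g p ⊔ ⨆ y : Fin 2, g (p.1, y) * g (y, p.2)

/-- Iterating the transitivity operator yields an increasing chain. -/
theorem monotone_Gop_iterate (g : Fin 2 × Fin 2 → Language (Fin 2)) :
    Monotone fun n : ℕ => Gop^[n] g := by
  refine monotone_nat_of_le_succ fun n p => ?_
  rw [Function.iterate_succ_apply']
  exact le_sup_left

theorem mul_le_Gop (g : Fin 2 × Fin 2 → Language (Fin 2)) (x y z : Fin 2) :
    g (x, y) * g (y, z) ≤ Gop g (x, z) :=
  le_sup_of_le_right (le_iSup (fun y => g (x, y) * g (y, z)) y)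

/-- The union of the iterates of `Gop` is the least transitive function above `f`. -/
theorem isLeast_iSup_Gop_iterate (f : Fin 2 × Fin 2 → Language (Fin 2)) :
    IsLeast {g : Fin 2 × Fin 2 → Language (Fin 2) |
        (∀ p, f p ≤ g p) ∧ ∀ x y z : Fin 2, g (x, y) * g (y, z) ≤ g (x, z)}
      (fun p => ⨆ n : ℕ, Gop^[n] f p) := by
  refine ⟨⟨fun p => le_iSup (fun n => Gop^[n] f p) 0, fun x y z => ?_⟩, ?_⟩
  · simp only [Language.iSup_mul, Language.mul_iSup]
    refine iSup_le fun m => iSup_le fun n => ?_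
    refine le_trans (mul_le_mul' (monotone_Gop_iterate f (le_max_left n m) _)
      (monotone_Gop_iterate f (le_max_right n m) _)) ?_
    refine le_trans (mul_le_Gop _ x y z) ?_
    rw [← Function.iterate_succ_apply' Gop]
    exact le_iSup (fun n => Gop^[n] f (x, z)) _
  · rintro g ⟨hf, hg⟩ p
    refine iSup_le fun n => ?_
    induction n generalizing p with
    | zero => exact hf p
    | succ n ih =>
      rw [Function.iterate_succ_apply']
      exact sup_le (ih p) (iSup_le fun y => (mul_le_mul' (ih _) (ih _)).trans (hg _ _ _))

/-- One half of the sliding rule of Kleene algebra. -/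
theorem mul_kstar_mul_le {K : Type*} [KleeneAlgebra K] (a b : K) :
    a * (b * a)∗ ≤ (a * b)∗ * a := by
  refine mul_kstar_le (le_mul_of_one_le_left' one_le_kstar) ?_
  calc (a * b)∗ * a * (b * a) = (a * b)∗ * (a * b) * a := by simp only [mul_assoc]
    _ ≤ (a * b)∗ * a := mul_le_mul' kstar_mul_le_kstar le_rfl

/-- The words labelling walks in the two-state automaton with an edge `0 → 1` labelled by `a`
and an edge `1 → 0` labelled by `b`. -/
def walkLanguage (a b : Language (Fin 2)) : Fin 2 × Fin 2 → Language (Fin 2) := fun p =>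
  if p.1 = 0 then (if p.2 = 0 then (a * b)∗ else (a * b)∗ * a)
  else (if p.2 = 0 then (b * a)∗ * b else (b * a)∗)

theorem walkLanguage_mul_le (a b : Language (Fin 2)) (x y z : Fin 2) :
    walkLanguage a b (x, y) * walkLanguage a b (y, z) ≤ walkLanguage a b (x, z) := by
  have absorb : ∀ a b : Language (Fin 2), (a * b)∗ * a * (b * a)∗ ≤ (a * b)∗ * a := fun a b =>
    calc (a * b)∗ * a * (b * a)∗ = (a * b)∗ * (a * (b * a)∗) := mul_assoc _ _ _
      _ ≤ (a * b)∗ * ((a * b)∗ * a) := mul_le_mul' le_rfl (mul_kstar_mul_le a b)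
      _ = (a * b)∗ * a := by rw [← mul_assoc, kstar_mul_kstar]
  have close : ∀ a b : Language (Fin 2), (a * b)∗ * a * ((b * a)∗ * b) ≤ (a * b)∗ := fun a b =>
    calc (a * b)∗ * a * ((b * a)∗ * b) = (a * b)∗ * a * (b * a)∗ * b := (mul_assoc _ _ _).symm
      _ ≤ (a * b)∗ * a * b := mul_le_mul' (absorb a b) le_rfl
      _ = (a * b)∗ * (a * b) := mul_assoc _ _ _
      _ ≤ (a * b)∗ := kstar_mul_le_kstar
  have extend : ∀ a b : Language (Fin 2), (a * b)∗ * ((a * b)∗ * a) ≤ (a * b)∗ * a := fun a b => by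
    rw [← mul_assoc, kstar_mul_kstar]
  fin_cases x <;> fin_cases y <;> fin_cases z
  · exact (kstar_mul_kstar _).le
  · exact extend a b
  · exact close a b
  · exact absorb a b
  · exact absorb b a
  · exact close b a
  · exact extend b a
  · exact (kstar_mul_kstar _).le

theorem exitF_le_walkLanguage (p : Fin 2 × Fin 2) : exitF p ≤ walkLanguage {[0]} {[1]} p := by
  obtain ⟨x, y⟩ := p
  fin_cases x <;> fin_cases y
  · exact one_le_kstar
  · exact le_mul_of_one_le_left' one_le_kstar
  · exact le_mul_of_one_le_left' one_le_kstar
  · exact one_le_kstar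

/-- The pointwise union `W = ⋃_n G^n(f)` is the least function `g` with `f ≤ g`
pointwise and `g(xy)·g(yz) ⊆ g(xz)` for all `x, y, z`, and it satisfies
`W(ab) = ({u}·{v})*·{u}`, i.e. `W(ab) = { (uv)^n u | n ∈ ℕ }`. -/
theorem trio_fixpoint_example :
    IsLeast {g : Fin 2 × Fin 2 → Language (Fin 2) |
        (∀ p, exitF p ≤ g p) ∧ ∀ x y z : Fin 2, g (x, y) * g (y, z) ≤ g (x, z)}
      (fun p => ⨆ n : ℕ, Gop^[n] exitF p) ∧
    (⨆ n : ℕ, Gop^[n] exitF (0, 1)) =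
      (({[0]} : Language (Fin 2)) * {[1]})∗ * {[0]} := by
  have hW := isLeast_iSup_Gop_iterate exitF
  refine ⟨hW, le_antisymm ?_ ?_⟩
  · exact hW.2 ⟨exitF_le_walkLanguage, walkLanguage_mul_le _ _⟩ (0, 1)
  · obtain ⟨hf, hg⟩ := hW.1
    refine kstar_mul_le (hf (0, 1)) (le_trans (mul_le_mul' ?_ le_rfl) (hg 0 0 1))
    exact le_trans (mul_le_mul' (hf (0, 1)) (hf (1, 0))) (hg 0 1 0)
end

section
/- Let n ∈ ℕ and let u_0, v_0, w_0, x_0, …, u_{n-1}, v_{n-1}, w_{n-1}, x_{n-1} be 4n pairwise distinct symbols (e.g., the alphabet Fin n × Fin 4). Then there exists an NFA with state type Fin (3n+1) (i.e., with exactly 3n+1 states) whose accepted language is the concatenation language ∏_{i=0}^{n-1} ( {u_i v_i} ∪ {w_i x_i} ). -/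
/-- The language `∏_{i=0}^{n-1} ({u_i v_i} ∪ {w_i x_i})` over the alphabet
`Fin n × Fin 4` of `4n` pairwise distinct symbols, where `u_i = (i,0)`,
`v_i = (i,1)`, `w_i = (i,2)`, `x_i = (i,3)`. -/
def minecraftLang (n : ℕ) : Language (Fin n × Fin 4) :=
  ((List.finRange n).map (fun i : Fin n =>
    (({[(i, 0), (i, 1)]} : Language (Fin n × Fin 4)) ⊔ {[(i, 2), (i, 3)]}))).prod

/-- The state in which the symbol `a` can be read: state `3 * i` is reached after `i` complete
factors, and `3 * i + 1`, `3 * i + 2` after further reading `(i, 0)`, `(i, 2)` respectively. -/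
def minecraftSource {n : ℕ} (a : Fin n × Fin 4) : Fin (3 * n + 1) :=
  ⟨3 * a.1 + ![0, 1, 0, 2] a.2, by obtain ⟨i, c⟩ := a; fin_cases c <;> simp <;> omega⟩

/-- The state entered by reading the symbol `a`. -/
def minecraftTarget {n : ℕ} (a : Fin n × Fin 4) : Fin (3 * n + 1) :=
  ⟨3 * a.1 + ![1, 3, 2, 3] a.2, by obtain ⟨i, c⟩ := a; fin_cases c <;> simp <;> omega⟩

/-- An NFA for `minecraftLang n` in which every symbol labels exactly one transition. -/
def minecraftNFA (n : ℕ) : NFA (Fin n × Fin 4) (Fin (3 * n + 1)) where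
  step s a := {t | s = minecraftSource a ∧ t = minecraftTarget a}
  start := {0}
  accept := {Fin.last _}

lemma NFA.evalFrom_empty {α σ : Type*} (M : NFA α σ) (x : List α) : M.evalFrom ∅ x = ∅ := by
  induction x with
  | nil => rfl
  | cons a x ih => simpa using ih

lemma mem_minecraftNFA_evalFrom_cons {n : ℕ} {s t : Fin (3 * n + 1)} {a : Fin n × Fin 4}
    {x : List (Fin n × Fin 4)} :
    t ∈ (minecraftNFA n).evalFrom {s} (a :: x) ↔
      s = minecraftSource a ∧ t ∈ (minecraftNFA n).evalFrom {minecraftTarget a} x := by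
  by_cases h : s = minecraftSource a
  · simp [minecraftNFA, h]
  · simp [minecraftNFA, h, NFA.evalFrom_empty]

lemma Language.mem_pair_sup_pair_mul {α : Type*} {a b c d : α} {L : Language α} {x : List α} :
    x ∈ (({[a, b]} : Language α) ⊔ {[c, d]}) * L ↔
      ∃ y ∈ L, x = a :: b :: y ∨ x = c :: d :: y := by
  have h (u : List α) : u ∈ (({[a, b]} : Language α) ⊔ {[c, d]}) ↔ u = [a, b] ∨ u = [c, d] :=
    Iff.rfl
  simp only [Language.mem_mul, h]
  constructor
  · rintro ⟨u, rfl | rfl, y, hy, rfl⟩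
    exacts [⟨y, hy, .inl rfl⟩, ⟨y, hy, .inr rfl⟩]
  · rintro ⟨y, hy, rfl | rfl⟩
    exacts [⟨_, .inl rfl, y, hy, rfl⟩, ⟨_, .inr rfl, y, hy, rfl⟩]

/-- Reading from state `3 * k` to the final state means reading the factors from index `k` on. -/
lemma last_mem_minecraftNFA_evalFrom_iff {n k : ℕ} (hk : k ≤ n) (x : List (Fin n × Fin 4)) :
    Fin.last (3 * n) ∈ (minecraftNFA n).evalFrom {⟨3 * k, by omega⟩} x ↔
      x ∈ (((List.finRange n).drop k).map (fun i : Fin n =>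
        (({[(i, 0), (i, 1)]} : Language (Fin n × Fin 4)) ⊔ {[(i, 2), (i, 3)]}))).prod := by
  induction hk using Nat.decreasingInduction generalizing x with
  | self =>
    rw [List.drop_eq_nil_of_le (by simp), List.map_nil, List.prod_nil, Language.mem_one]
    cases x with
    | nil => simp [Fin.ext_iff]
    | cons a x =>
      rw [mem_minecraftNFA_evalFrom_cons]
      obtain ⟨i, c⟩ := a
      have := i.2
      fin_cases c <;> simp [minecraftSource] <;> omega
  | of_succ k hk ih =>
    rw [List.drop_eq_getElem_cons (by simpa using hk), List.map_cons, List.prod_cons,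
      Language.mem_pair_sup_pair_mul]
    simp only [← ih, List.getElem_finRange, Fin.cast_mk]
    constructor
    · rcases x with _ | ⟨⟨i, c⟩, _ | ⟨⟨j, d⟩, y⟩⟩
      · simp [Fin.ext_iff]; omega
      · rw [mem_minecraftNFA_evalFrom_cons]
        have := i.2
        fin_cases c <;> simp [minecraftSource, minecraftTarget, Fin.ext_iff] <;> omega
      · simp only [mem_minecraftNFA_evalFrom_cons]
        rintro ⟨h₁, h₂, h₃⟩
        refine ⟨y, ?_, ?_⟩
        · convert h₃ using 3
          fin_cases c <;> fin_cases d <;>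
            simp [minecraftSource, minecraftTarget, Fin.ext_iff] at h₁ h₂ ⊢ <;> omega
        · fin_cases c <;> fin_cases d <;>
            simp [minecraftSource, minecraftTarget, Fin.ext_iff] at h₁ h₂ ⊢ <;> omega
    · rintro ⟨y, hy, rfl | rfl⟩ <;> simp only [mem_minecraftNFA_evalFrom_cons] <;>
        exact ⟨rfl, rfl, hy⟩

/-- There is an NFA with exactly `3n + 1` states accepting the language
`∏_{i=0}^{n-1} ({u_i v_i} ∪ {w_i x_i})`. -/
theorem minecraftLang_small_nfa (n : ℕ) :
    ∃ M : NFA (Fin n × Fin 4) (Fin (3 * n + 1)), M.accepts = minecraftLang n := by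
  refine ⟨minecraftNFA n, Set.ext fun x => ?_⟩
  refine Iff.trans ?_ (last_mem_minecraftNFA_evalFrom_iff n.zero_le x)
  change (∃ s ∈ ({Fin.last _} : Set _), s ∈ (minecraftNFA n).evalFrom {0} x) ↔ _
  simp
end
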